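/- (Lemma 4.4, local model: convex combinations of horocycle structures.) Let δ₀, δ₁ > 0 and let f₀, f₁ : ℂ → ℂ be holomorphic (ℂ-differentiable) on the open balls Metric.ball 0 δ₀ and Metric.ball 0 δ₁ respectively, with f₀ 0 = f₁ 0 = 0, deriv f₀ 0 = deriv f₁ 0 = 1, and with fₖ injective on Metric.ball 0 δₖ for k = 0, 1. Then there exists δ with 0 < δ ≤ min δ₀ δ₁ such that for every t ∈ [0,1], the convex combination g_t : z ↦ (1 - t) • f₀ z + t • f₁ z satisfies g_t 0 = 0, deriv g_t 0 = 1, and g_t is injective on Metric.ball 0 δ. (The crucial point is that the radius δ can be chosen uniformly in t ∈ [0,1].) -/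

import Mathlib

open Metric Set

/-- Near a point where it has strict derivative `1`, a function is the identity up to a
map with Lipschitz constant `1 / 2`. -/
theorem HasStrictDerivAt.exists_ball_norm_sub_sub_le {f : ℂ → ℂ} {a : ℂ}
    (hf : HasStrictDerivAt f 1 a) :
    ∃ r : ℝ, 0 < r ∧ ∀ x ∈ ball a r, ∀ y ∈ ball a r,
      ‖f x - f y - (x - y)‖ ≤ 1 / 2 * ‖x - y‖ := by
  have h := hf.hasStrictFDerivAt.isLittleO.bound (by norm_num : (0 : ℝ) < 1 / 2)
  obtain ⟨r, hr, hball⟩ := Metric.eventually_nhds_iff_ball.mp h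
  refine ⟨r, hr, fun x hx y hy => ?_⟩
  have hxy : (x, y) ∈ ball (a, a) r := by
    rw [← ball_prod_same]
    exact ⟨hx, hy⟩
  simpa using hball (x, y) hxy

/-- Lemma 4.4, local model: convex combinations of horocycle structures. Given two
holomorphic injective maps `f₀, f₁` on balls about `0` with `fₖ 0 = 0` and
`fₖ' 0 = 1`, there is a uniform radius `δ > 0` such that for every `t ∈ [0,1]` the
convex combination `g_t = (1-t) f₀ + t f₁` satisfies `g_t 0 = 0`, `g_t' 0 = 1`, and
`g_t` is injective on the ball of radius `δ`. -/
theorem convex_combination_horocycle (δ₀ δ₁ : ℝ) (hδ₀ : 0 < δ₀) (hδ₁ : 0 < δ₁)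
    (f₀ f₁ : ℂ → ℂ)
    (hf₀ : DifferentiableOn ℂ f₀ (ball (0 : ℂ) δ₀))
    (hf₁ : DifferentiableOn ℂ f₁ (ball (0 : ℂ) δ₁))
    (hf₀0 : f₀ 0 = 0) (hf₁0 : f₁ 0 = 0)
    (hd₀ : deriv f₀ 0 = 1) (hd₁ : deriv f₁ 0 = 1)
    (hi₀ : InjOn f₀ (ball (0 : ℂ) δ₀)) (hi₁ : InjOn f₁ (ball (0 : ℂ) δ₁)) :
    ∃ δ : ℝ, 0 < δ ∧ δ ≤ min δ₀ δ₁ ∧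
      ∀ t ∈ Icc (0 : ℝ) 1,
        (fun z : ℂ => (1 - t) • f₀ z + t • f₁ z) 0 = 0 ∧
        deriv (fun z : ℂ => (1 - t) • f₀ z + t • f₁ z) 0 = 1 ∧
        InjOn (fun z : ℂ => (1 - t) • f₀ z + t • f₁ z) (ball (0 : ℂ) δ) := by
  have hs₀ : HasStrictDerivAt f₀ 1 0 :=
    hd₀ ▸ (hf₀.analyticAt (ball_mem_nhds 0 hδ₀)).hasStrictDerivAt
  have hs₁ : HasStrictDerivAt f₁ 1 0 :=
    hd₁ ▸ (hf₁.analyticAt (ball_mem_nhds 0 hδ₁)).hasStrictDerivAt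
  obtain ⟨r₀, hr₀, h₀⟩ := hs₀.exists_ball_norm_sub_sub_le
  obtain ⟨r₁, hr₁, h₁⟩ := hs₁.exists_ball_norm_sub_sub_le
  refine ⟨min (min δ₀ δ₁) (min r₀ r₁), by positivity, min_le_left _ _, fun t ht => ⟨?_, ?_, ?_⟩⟩
  · simp [hf₀0, hf₁0]
  · have h := ((hs₀.hasDerivAt.const_smul (1 - t)).add (hs₁.hasDerivAt.const_smul t)).deriv
    rw [← add_smul, sub_add_cancel, one_smul] at h
    exact h
  · intro x hx y hy hxy
    have hle₀ : min (min δ₀ δ₁) (min r₀ r₁) ≤ r₀ := (min_le_right _ _).trans (min_le_left _ _)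
    have hle₁ : min (min δ₀ δ₁) (min r₀ r₁) ≤ r₁ := (min_le_right _ _).trans (min_le_right _ _)
    have hmem := convex_closedBall (0 : ℂ) (1 / 2 * ‖x - y‖)
      (mem_closedBall_zero_iff.mpr
        (h₀ x (ball_subset_ball hle₀ hx) y (ball_subset_ball hle₀ hy)))
      (mem_closedBall_zero_iff.mpr
        (h₁ x (ball_subset_ball hle₁ hx) y (ball_subset_ball hle₁ hy)))
      (sub_nonneg.mpr ht.2) ht.1 (sub_add_cancel 1 t)
    have heq : (1 - t) • (f₀ x - f₀ y - (x - y)) + t • (f₁ x - f₁ y - (x - y)) = y - x := by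
      simp only [Complex.real_smul] at hxy ⊢
      push_cast at hxy ⊢
      linear_combination hxy
    rw [heq, mem_closedBall_zero_iff, norm_sub_rev] at hmem
    have : ‖x - y‖ ≤ 0 := by linarith
    exact sub_eq_zero.mp (norm_le_zero_iff.mp this)
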